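/- Let S ⊆ ℝ^n be a semialgebraic set that is Zariski dense in ℝ^n (i.e., the only polynomial in ℝ[x_1,…,x_n] vanishing identically on S is 0). Let L ⊆ ℝ[x_1,…,x_n] be a finite-dimensional ℝ-linear subspace with 1 ∉ L, fix a basis g_1, …, g_k of L, and let φ_L : ℝ^n → ℝ^k be given by φ_L(ξ) = (g_1(ξ),…,g_k(ξ)). Assume that for every η ∈ S there exists f ∈ ℝ·1 + L with f(ξ) ≥ 0 for all ξ ∈ S, such that the polynomial f(x_1+η_1, …, x_n+η_n), regarded as an element of the formal power series ring ℝ[[x_1,…,x_n]], is not a finite sum of squares in ℝ[[x_1,…,x_n]]. Then the closed convex hull of φ_L(S) in ℝ^k is not a spectrahedral shadow. -/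

import Mathlib

/-- A set `K ⊆ ℝ^k` is a spectrahedral shadow if it is the feasible-region projection of a
symmetric linear matrix inequality. -/
def IsSpectrahedralShadow {k : ℕ} (K : Set (Fin k → ℝ)) : Prop :=
  ∃ (d m : ℕ), 0 < d ∧ ∃ (A : Matrix (Fin d) (Fin d) ℝ)
    (B : Fin k → Matrix (Fin d) (Fin d) ℝ) (C : Fin m → Matrix (Fin d) (Fin d) ℝ),
    A.IsSymm ∧ (∀ i, (B i).IsSymm) ∧ (∀ j, (C j).IsSymm) ∧
    K = {ξ | ∃ η : Fin m → ℝ, (A + ∑ i, ξ i • B i + ∑ j, η j • C j).PosSemidef}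

/-- A set `S ⊆ ℝ^n` is semialgebraic: a finite union of sets given by one polynomial
equation and finitely many strict polynomial inequalities. -/
def IsSemialgebraic {n : ℕ} (S : Set (Fin n → ℝ)) : Prop :=
  ∃ (r : ℕ) (p : Fin r → MvPolynomial (Fin n) ℝ) (s : Fin r → ℕ)
    (q : (i : Fin r) → Fin (s i) → MvPolynomial (Fin n) ℝ),
    S = ⋃ i, {ξ | MvPolynomial.eval ξ (p i) = 0 ∧ ∀ j, 0 < MvPolynomial.eval ξ (q i j)}

theorem exists_ringHom_lift_of_formallySmooth {R A T : Type*} [CommRing R] [CommRing A]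
    [CommRing T] [Algebra R A] [Algebra.FormallySmooth R A] (I : Ideal T) [IsAdicComplete I T]
    (ψ : R →+* T) (φ : A →+* T ⧸ I)
    (h : φ.comp (algebraMap R A) = (Ideal.Quotient.mk I).comp ψ) :
    ∃ Φ : A →+* T, Φ.comp (algebraMap R A) = ψ := by
  let : Algebra R T := ψ.toAlgebra
  let φ' : A →ₐ[R] T ⧸ I := { φ with commutes' := fun r => congrArg (fun f => f r) h }
  obtain ⟨g, -⟩ := Algebra.FormallySmooth.exists_mkₐ_comp_eq_of_isAdicComplete φ'
  exact ⟨g.toRingHom, g.comp_algebraMap⟩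

theorem exists_ne_zero_smooth_away {R A : Type*} [CommRing R] [IsDomain R]
    [IsNoetherianRing R] [CharZero R] [CommRing A] [IsDomain A] [Algebra R A]
    [Algebra.FiniteType R A] (hinj : Function.Injective (algebraMap R A)) :
    ∃ h : A, h ≠ 0 ∧ Algebra.Smooth R (Localization.Away h) := by
  have : FaithfulSMul R A := (faithfulSMul_iff_algebraMap_injective R A).mpr hinj
  let K := FractionRing R
  let F := Localization.AtPrime (⊥ : Ideal A)
  have : Algebra.FinitePresentation R A := Algebra.FinitePresentation.of_finiteType.mp ‹_›
  have : IsFractionRing A F := by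
    have key : ∀ M : Submonoid A, M = nonZeroDivisors A → IsFractionRing A (Localization M) := by
      rintro _ rfl
      infer_instance
    exact key _ (by ext x; simp [Ideal.primeCompl])
  let : Field F := IsFractionRing.toField A
  have : FaithfulSMul A F := (faithfulSMul_iff_algebraMap_injective A F).mpr
    (IsFractionRing.injective A F)
  have : FaithfulSMul R F := .trans R A F
  let : Algebra K F := FractionRing.liftAlgebra R F
  have : IsScalarTower R K F := FractionRing.isScalarTower_liftAlgebra R F
  have : Algebra.EssFiniteType R F := Algebra.EssFiniteType.comp R A F
  have : Algebra.EssFiniteType K F := Algebra.EssFiniteType.of_comp R K F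
  have : CharZero K := inferInstance
  have : Algebra.FormallySmooth K F := Algebra.FormallySmooth.of_perfectField
  have : Algebra.FormallySmooth R K :=
    Algebra.FormallySmooth.of_isLocalization (nonZeroDivisors R)
  have : Algebra.IsSmoothAt R (⊥ : Ideal A) := Algebra.FormallySmooth.comp R K F
  obtain ⟨h, hh, hs⟩ := Algebra.IsSmoothAt.exists_notMem_smooth R (⊥ : Ideal A)
  exact ⟨h, by simpa using hh, hs⟩

/-- Generic smoothness of the quotient by a prime ideal, stated as a lifting property: outside a
proper closed subset, a point of the quotient lifts to an adically complete ring. -/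
theorem exists_notMem_forall_exists_ringHom_lift {R B T k : Type*} [CommRing R] [IsDomain R]
    [IsNoetherianRing R] [CharZero R] [CommRing B] [Algebra R B] [Algebra.FiniteType R B]
    [CommRing T] [Field k] (P : Ideal B) [P.IsPrime]
    (hinj : ∀ r, algebraMap R B r ∈ P → r = 0) (I : Ideal T) [IsAdicComplete I T] (c : k →+* T) :
    ∃ h ∉ P, ∀ (ψ : R →+* T) (φ : B →+* k), (∀ p ∈ P, φ p = 0) → φ h ≠ 0 →
      (∀ r, ψ r - c (φ (algebraMap R B r)) ∈ I) →
      ∃ Φ : B →+* T, Φ.comp (algebraMap R B) = ψ ∧ ∀ p ∈ P, Φ p = 0 := by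
  have hinj' : Function.Injective (algebraMap R (B ⧸ P)) := by
    rw [injective_iff_map_eq_zero]
    exact fun r hr => hinj r (Ideal.Quotient.eq_zero_iff_mem.mp hr)
  obtain ⟨h, hh0, hsm⟩ := exists_ne_zero_smooth_away (R := R) (A := B ⧸ P) hinj'
  obtain ⟨h, rfl⟩ := Ideal.Quotient.mk_surjective h
  refine ⟨h, fun hm => hh0 (Ideal.Quotient.eq_zero_iff_mem.mpr hm), fun ψ φ hφ hφh hψ => ?_⟩
  let φ₀ := Ideal.Quotient.lift P φ hφ
  let φ₁ : Localization.Away (Ideal.Quotient.mk P h) →+* k :=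
    IsLocalization.Away.lift (Ideal.Quotient.mk P h) (g := φ₀) (by simpa [φ₀] using hφh)
  obtain ⟨Φ, hΦ⟩ := exists_ringHom_lift_of_formallySmooth I ψ
    (((Ideal.Quotient.mk I).comp c).comp φ₁) (by
      refine RingHom.ext fun r => ?_
      have : φ₁ (algebraMap R _ r) = φ (algebraMap R B r) := by
        rw [IsScalarTower.algebraMap_apply R (B ⧸ P)]
        simp only [φ₁, IsLocalization.Away.lift_eq]
        rfl
      simp only [RingHom.comp_apply, this]
      exact (Ideal.Quotient.eq.mpr (hψ r)).symm)
  refine ⟨(Φ.comp (algebraMap (B ⧸ P) _)).comp (Ideal.Quotient.mk P), hΦ, fun p hp => ?_⟩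
  simp [Ideal.Quotient.eq_zero_iff_mem.mpr hp]

/-- Given a family of real-valued functions `v` on a Zariski dense set `S`, there is a point of `S`
at which the polynomial relations between the coordinates and `v` have a formal solution. -/
theorem exists_formal_section_of_zariski_dense {n : ℕ} {τ : Type*} [Finite τ]
    {S : Set (Fin n → ℝ)}
    (hdense : ∀ f : MvPolynomial (Fin n) ℝ, (∀ ξ ∈ S, MvPolynomial.eval ξ f = 0) → f = 0)
    (v : (Fin n → ℝ) → τ → ℝ) :
    ∃ s ∈ S, ∃ Ψ : MvPolynomial τ (MvPolynomial (Fin n) ℝ) →+* MvPowerSeries (Fin n) ℝ,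
      (∀ f, Ψ (MvPolynomial.C f) = ((MvPolynomial.aeval
          (fun i => MvPolynomial.X i + MvPolynomial.C (s i)) f :
            MvPolynomial (Fin n) ℝ) : MvPowerSeries (Fin n) ℝ)) ∧
      ∀ p, (∀ ξ ∈ S, MvPolynomial.eval₂ (MvPolynomial.eval ξ) (v ξ) p = 0) → Ψ p = 0 := by
  classical
  let e : (Fin n → ℝ) → MvPolynomial τ (MvPolynomial (Fin n) ℝ) →+* ℝ :=
    fun ξ => MvPolynomial.eval₂Hom (MvPolynomial.eval ξ) (v ξ)
  have he : ∀ ξ f, e ξ (MvPolynomial.C f) = MvPolynomial.eval ξ f := fun ξ f => by simp [e]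
  let Z : Ideal (MvPolynomial τ (MvPolynomial (Fin n) ℝ)) → Set (Fin n → ℝ) :=
    fun I => {ξ ∈ S | ∀ p ∈ I, e ξ p = 0}
  let D : Set (Ideal (MvPolynomial τ (MvPolynomial (Fin n) ℝ))) :=
    {I | ∀ f : MvPolynomial (Fin n) ℝ, (∀ ξ ∈ Z I, MvPolynomial.eval ξ f = 0) → f = 0}
  have hD : D.Nonempty := ⟨⊥, fun f hf => hdense f fun ξ hξ => hf ξ ⟨hξ, by simp⟩⟩
  obtain ⟨P, hP, hmax⟩ : ∃ P : Ideal (MvPolynomial τ (MvPolynomial (Fin n) ℝ)),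
      P ∈ D ∧ ∀ I ∈ D, ¬P < I := set_has_maximal_iff_noetherian.mpr
    (inferInstance : IsNoetherian (MvPolynomial τ (MvPolynomial (Fin n) ℝ)) _) D hD
  have hsup : ∀ a ξ, ξ ∈ Z P → e ξ a = 0 → ξ ∈ Z (P ⊔ Ideal.span {a}) := by
    rintro a ξ ⟨hξ, hp⟩ ha
    refine ⟨hξ, fun q hq => ?_⟩
    have : P ⊔ Ideal.span {a} ≤ RingHom.ker (e ξ) :=
      sup_le (fun p => hp p) ((Ideal.span_singleton_le_iff_mem _).2 ha)
    exact this hq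
  have hnot : ∀ a ∉ P, ∃ f : MvPolynomial (Fin n) ℝ, f ≠ 0 ∧
      ∀ ξ ∈ Z P, e ξ a = 0 → MvPolynomial.eval ξ f = 0 := by
    intro a ha
    have h1 : P ⊔ Ideal.span {a} ∉ D := fun h => hmax _ h <| lt_of_le_of_ne le_sup_left
      fun heq => ha (heq ▸ Ideal.mem_sup_right (Ideal.mem_span_singleton_self a))
    simp only [D, Set.mem_ofPred_eq, not_forall] at h1
    obtain ⟨f, hf, hf0⟩ := h1
    exact ⟨f, hf0, fun ξ hξ h => hf ξ (hsup a ξ hξ h)⟩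
  have hvan : ∀ p, (∀ ξ ∈ S, e ξ p = 0) → p ∈ P := by
    intro p hp
    by_contra h
    obtain ⟨f, hf0, hf⟩ := hnot p h
    exact hf0 (hP f fun ξ hξ => hf ξ hξ (hp ξ hξ.1))
  have hprime : P.IsPrime := by
    refine ⟨fun h => one_ne_zero (hP 1 fun ξ hξ => ?_), fun {a b} hab => ?_⟩
    · have := hξ.2 1 (h ▸ Submodule.mem_top)
      simp at this
    · by_contra! hc
      obtain ⟨f, hf0, hf⟩ := hnot a hc.1
      obtain ⟨f', hf0', hf'⟩ := hnot b hc.2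
      refine mul_ne_zero hf0 hf0' (hP _ fun ξ hξ => ?_)
      have := hξ.2 _ hab
      rw [map_mul, mul_eq_zero] at this
      rw [map_mul, mul_eq_zero]
      exact this.imp (hf ξ hξ) (hf' ξ hξ)
  let I : Ideal (MvPowerSeries (Fin n) ℝ) := Ideal.span (Set.range MvPowerSeries.X)
  obtain ⟨h, hhP, hlift⟩ := exists_notMem_forall_exists_ringHom_lift
    (R := MvPolynomial (Fin n) ℝ) P
    (fun f hf => hP f fun ξ hξ => (he ξ f).symm.trans (hξ.2 _ hf)) I MvPowerSeries.C
  obtain ⟨s, hs, hsh⟩ : ∃ s ∈ Z P, e s h ≠ 0 := by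
    by_contra! hc
    obtain ⟨f, hf0, hf⟩ := hnot h hhP
    exact hf0 (hP f fun ξ hξ => hf ξ hξ (hc ξ hξ))
  let ψ : MvPolynomial (Fin n) ℝ →+* MvPowerSeries (Fin n) ℝ :=
    MvPolynomial.coeToMvPowerSeries.ringHom.comp
      (MvPolynomial.aeval (fun i => MvPolynomial.X i + MvPolynomial.C (s i)) :
        MvPolynomial (Fin n) ℝ →ₐ[ℝ] MvPolynomial (Fin n) ℝ).toRingHom
  obtain ⟨Ψ, hΨ, hΨP⟩ := hlift ψ (e s) hs.2 hsh fun f => by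
    have : (Ideal.Quotient.mk I).comp ψ =
        ((Ideal.Quotient.mk I).comp MvPowerSeries.C).comp (MvPolynomial.eval s) := by
      ext i
      · simp [ψ]
      · simp only [ψ, I, RingHom.comp_apply, MvPolynomial.eval_X]
        rw [Ideal.Quotient.eq]
        have hX : (MvPowerSeries.X i : MvPowerSeries (Fin n) ℝ) ∈ I :=
          Ideal.subset_span (Set.mem_range_self i)
        simpa using hX
    rw [← Ideal.Quotient.eq]
    have hef : e s (algebraMap _ _ f) = MvPolynomial.eval s f := he s f
    rw [hef]
    exact congrArg (fun F => F f) this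
  exact ⟨s, hs.1, Ψ, fun f => congrArg (fun F => F f) hΨ, fun p hp => hΨP p (hvan p hp)⟩

open scoped Matrix MatrixOrder Matrix.Norms.L2Operator in
theorem Matrix.PosSemidef.exists_eq_transpose_mul_self {ι : Type*} [Fintype ι]
    {M : Matrix ι ι ℝ} (hM : M.PosSemidef) : ∃ R : Matrix ι ι ℝ, M = Rᵀ * R := by
  classical
  obtain ⟨R, hR⟩ := CStarAlgebra.nonneg_iff_eq_star_mul_self.mp hM.nonneg
  exact ⟨R, by rw [hR, Matrix.star_eq_conjTranspose,
    Matrix.conjTranspose_eq_transpose_of_trivial]⟩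

open Matrix in
theorem abs_dotProduct_mulVec_le {ι : Type*} [Fintype ι] (Y : Matrix ι ι ℝ) (z : ι → ℝ) :
    |z ⬝ᵥ Y *ᵥ z| ≤ (∑ i, ∑ j, |Y i j|) * (z ⬝ᵥ z) := by
  have hz : ∀ i, z i * z i ≤ z ⬝ᵥ z := fun i =>
    Finset.single_le_sum (f := fun i => z i * z i) (fun j _ => mul_self_nonneg _)
      (Finset.mem_univ i)
  have hab : ∀ i j, |z i * z j| ≤ z ⬝ᵥ z := fun i j => by
    rw [abs_le]
    constructor <;> nlinarith [hz i, hz j, sq_nonneg (z i + z j), sq_nonneg (z i - z j)]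
  calc |z ⬝ᵥ Y *ᵥ z| = |∑ i, ∑ j, Y i j * (z i * z j)| := by
        simp only [dotProduct, mulVec, Finset.mul_sum]
        congr 1
        exact Finset.sum_congr rfl fun i _ => Finset.sum_congr rfl fun j _ => by ring
    _ ≤ ∑ i, ∑ j, |Y i j| * (z ⬝ᵥ z) := by
        refine (Finset.abs_sum_le_sum_abs _ _).trans (Finset.sum_le_sum fun i _ =>
          (Finset.abs_sum_le_sum_abs _ _).trans (Finset.sum_le_sum fun j _ => ?_))
        rw [abs_mul]
        exact mul_le_mul_of_nonneg_left (hab i j) (abs_nonneg _)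
    _ = _ := by simp only [Finset.sum_mul]

open Matrix in
/-- On the range of a positive semidefinite matrix `M`, every quadratic form is dominated by a
multiple of `M`. -/
theorem Matrix.PosSemidef.exists_forall_nonneg_on_range {ι : Type*} [Fintype ι]
    {M : Matrix ι ι ℝ} (hM : M.PosSemidef) (Y : Matrix ι ι ℝ) :
    ∃ N : ℝ, ∀ w, 0 ≤ (M *ᵥ w) ⬝ᵥ (N • M + Y) *ᵥ (M *ᵥ w) := by
  classical
  obtain ⟨R, hR⟩ := hM.exists_eq_transpose_mul_self
  have hMt : Mᵀ = M := by rw [hR]; simp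
  let f := M.mulVecLin.domRestrict (LinearMap.range M.mulVecLin)
  have hf : LinearMap.ker f = ⊥ := by
    rw [LinearMap.ker_eq_bot']
    rintro ⟨u, w, rfl⟩ hu
    have hu : M *ᵥ (M *ᵥ w) = 0 := hu
    have : (M *ᵥ w) ⬝ᵥ (M *ᵥ w) = 0 := by
      rw [dotProduct_mulVec, ← mulVec_transpose, hMt, hu, zero_dotProduct]
    simpa using dotProduct_self_eq_zero.mp this
  obtain ⟨g, hg⟩ := f.exists_leftInverse_of_injective hf
  let D := LinearMap.toMatrix' ((LinearMap.range M.mulVecLin).subtype ∘ₗ g)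
  have hD : ∀ w, D *ᵥ (M *ᵥ (M *ᵥ w)) = M *ᵥ w := fun w => by
    have h := congrArg Subtype.val
      (LinearMap.congr_fun hg ⟨M *ᵥ w, LinearMap.mem_range_self M.mulVecLin w⟩)
    rw [← toLin'_apply, toLin'_toMatrix']
    exact h
  let E := D * Rᵀ
  let Y' := Eᵀ * Y * E
  refine ⟨∑ i, ∑ j, |Y' i j|, fun w => ?_⟩
  set u := M *ᵥ w with hu
  have hE : u = E *ᵥ (R *ᵥ u) := by
    rw [← mulVec_mulVec, mulVec_mulVec _ Rᵀ, ← hR, hD]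
  have h1 : u ⬝ᵥ M *ᵥ u = (R *ᵥ u) ⬝ᵥ (R *ᵥ u) := by
    rw [hR, ← mulVec_mulVec, dotProduct_mulVec, vecMul_transpose]
  have h2 : u ⬝ᵥ Y *ᵥ u = (R *ᵥ u) ⬝ᵥ Y' *ᵥ (R *ᵥ u) := by
    conv_lhs => rw [hE]
    simp only [Y', ← mulVec_mulVec]
    rw [dotProduct_mulVec _ Eᵀ, vecMul_transpose]
  rw [add_mulVec, smul_mulVec, dotProduct_add, dotProduct_smul, smul_eq_mul, h1, h2]
  have := abs_le.mp (abs_dotProduct_mulVec_le Y' (R *ᵥ u))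
  linarith [this.1]

open Matrix in
/-- A symmetric matrix whose quadratic form is nonnegative on the range of a positive semidefinite
matrix and which kills the kernel of that matrix is positive semidefinite. -/
theorem Matrix.PosSemidef.of_nonneg_on_range {ι : Type*} [Fintype ι]
    {M X : Matrix ι ι ℝ} (hM : M.PosSemidef) (hX : X.IsSymm)
    (hker : ∀ u, M *ᵥ u = 0 → X *ᵥ u = 0)
    (h : ∀ w, 0 ≤ (M *ᵥ w) ⬝ᵥ X *ᵥ (M *ᵥ w)) : X.PosSemidef := by
  classical
  have hMt : Mᵀ = M := by simpa using hM.isHermitian.eq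
  have hM2 : ∀ w, M *ᵥ (M *ᵥ w) = 0 → M *ᵥ w = 0 := fun w hw => by
    have : (M *ᵥ w) ⬝ᵥ (M *ᵥ w) = 0 := by
      rw [dotProduct_mulVec, ← mulVec_transpose, hMt, hw, zero_dotProduct]
    exact dotProduct_self_eq_zero.mp this
  have hcompl : IsCompl (LinearMap.range M.mulVecLin) (LinearMap.ker M.mulVecLin) := by
    refine (Submodule.isCompl_iff_disjoint _ _
      M.mulVecLin.finrank_range_add_finrank_ker.ge).mpr (Submodule.disjoint_def.mpr ?_)
    rintro _ ⟨w, rfl⟩ hw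
    exact hM2 w hw
  refine .of_dotProduct_mulVec_nonneg (by simpa using hX) fun x => ?_
  obtain ⟨a, ⟨w, rfl⟩, b, hb, rfl⟩ := Submodule.mem_sup.mp
    (show x ∈ LinearMap.range M.mulVecLin ⊔ LinearMap.ker M.mulVecLin by
      rw [hcompl.sup_eq_top]; trivial)
  have hXb : X *ᵥ b = 0 := hker b hb
  have hbX : b ᵥ* X = 0 := by rw [← mulVec_transpose, hX, hXb]
  simp only [star_trivial, mulVec_add, hXb, add_zero, add_dotProduct, mulVecLin_apply]
  rw [dotProduct_mulVec b, hbX, zero_dotProduct, add_zero]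
  exact h w

open Matrix in
/-- Conic duality for the cone of positive semidefinite matrices, without a strict feasibility
assumption: the representing matrix is only asked to be correct on a given set of feasible
points. -/
theorem exists_trace_eq_of_nonneg_of_posSemidef {V ι : Type*} [AddCommGroup V] [Module ℝ V]
    [FiniteDimensional ℝ V] [Fintype ι] (A : V →ₗ[ℝ] Matrix ι ι ℝ) (hA : ∀ v, (A v).IsSymm)
    (l : V →ₗ[ℝ] ℝ) (hl : ∀ v, (A v).PosSemidef → 0 ≤ l v) (F : Set V)
    (hF : ∀ v ∈ F, (A v).PosSemidef) :
    ∃ R : Matrix ι ι ℝ, ∀ v ∈ F, l v = (R * A v * Rᵀ).trace := by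
  classical
  obtain ⟨t, htF, hspan⟩ : ∃ t : Finset V, ↑t ⊆ F ∧ Submodule.span ℝ F = Submodule.span ℝ t :=
    (Submodule.fg_span_iff_fg_span_finset_subset F).mp (IsNoetherian.noetherian _)
  let M := A (∑ x ∈ t, x)
  have hMsum : M = ∑ x ∈ t, A x := map_sum _ _ _
  have hM : M.PosSemidef := by
    rw [hMsum]
    exact posSemidef_sum _ fun x hx => hF x (htF hx)
  have hker : ∀ v ∈ Submodule.span ℝ F, ∀ u, M *ᵥ u = 0 → A v *ᵥ u = 0 := by
    intro v hv u hu
    have h0 : ∑ x ∈ t, u ⬝ᵥ A x *ᵥ u = 0 := by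
      rw [← dotProduct_sum, ← sum_mulVec, ← hMsum, hu, dotProduct_zero]
    rw [hspan] at hv
    induction hv using Submodule.span_induction with
    | mem x hx =>
      have hpos := fun y (hy : y ∈ t) => (hF y (htF hy)).dotProduct_mulVec_nonneg u
      have := (Finset.sum_eq_zero_iff_of_nonneg hpos).mp h0 x hx
      exact ((hF x (htF hx)).dotProduct_mulVec_zero_iff u).mp this
    | zero => simp
    | add x y _ _ hx hy => rw [map_add, add_mulVec, hx, hy, add_zero]
    | smul a x _ hx => rw [map_smul, smul_mulVec, hx, smul_zero]
  let s : PointedCone ℝ (V × Matrix ι ι ℝ) :=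
    { carrier := {p | ∀ w, 0 ≤ (M *ᵥ w) ⬝ᵥ (A p.1 + p.2) *ᵥ (M *ᵥ w)}
      zero_mem' := fun w => by simp
      add_mem' := fun {p q} hp hq w => by
        have := add_nonneg (hp w) (hq w)
        rw [← dotProduct_add, ← add_mulVec] at this
        simpa [add_add_add_comm] using this
      smul_mem' := fun c p hp w => by
        have := mul_nonneg c.2 (hp w)
        rw [← smul_eq_mul, ← dotProduct_smul, ← smul_mulVec] at this
        simpa [NNReal.smul_def, smul_add] using this }
  have hs : ∀ p, p ∈ s ↔ ∀ w, 0 ≤ (M *ᵥ w) ⬝ᵥ (A p.1 + p.2) *ᵥ (M *ᵥ w) := fun _ => Iff.rfl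
  let f : (V × Matrix ι ι ℝ) →ₗ.[ℝ] ℝ :=
    ⟨(Submodule.span ℝ F).prod ⊥, (l ∘ₗ LinearMap.fst ℝ V (Matrix ι ι ℝ)).domRestrict _⟩
  obtain ⟨g, hgf, hgs⟩ := riesz_extension s f (by
      rintro ⟨⟨v, X⟩, hv, hX⟩ hp
      obtain rfl : X = 0 := hX
      rw [hs] at hp
      simp only [add_zero] at hp
      exact hl v (hM.of_nonneg_on_range (hA v) (hker v hv) hp)) (by
      rintro ⟨v, X⟩
      obtain ⟨N, hN⟩ := hM.exists_forall_nonneg_on_range (A v + X)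
      refine ⟨⟨(N • ∑ x ∈ t, x, 0), Submodule.smul_mem _ _ (Submodule.sum_mem _ fun x hx =>
        Submodule.subset_span (htF hx)), rfl⟩, ?_⟩
      rw [hs]
      intro w
      have := hN w
      simpa [M, add_assoc] using this)
  have hgA : ∀ v, g (v, 0) = g (0, A v) := by
    intro v
    have h1 := hgs (v, -A v) ((hs _).mpr fun w => by simp)
    have h2 := hgs (-v, A v) ((hs _).mpr fun w => by simp)
    have e1 : g (v, -A v) = g (v, 0) - g (0, A v) := by rw [← map_sub]; simp
    have e2 : g (-v, A v) = g (0, A v) - g (v, 0) := by rw [← map_sub]; simp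
    linarith
  let φ : Matrix ι ι ℝ →ₗ[ℝ] ℝ := g ∘ₗ LinearMap.inr ℝ V (Matrix ι ι ℝ)
  let Q : Matrix ι ι ℝ := Matrix.of fun i j =>
    (φ (Matrix.single i j 1) + φ (Matrix.single j i 1)) / 2
  have hφ : ∀ X : Matrix ι ι ℝ, X.IsSymm → φ X = ∑ i, ∑ j, Q i j * X i j := by
    intro X hX
    have h1 : φ X = ∑ i, ∑ j, φ (Matrix.single i j 1) * X i j := by
      conv_lhs => rw [Matrix.matrix_eq_sum_single X]
      simp only [map_sum]
      refine Finset.sum_congr rfl fun i _ => Finset.sum_congr rfl fun j _ => ?_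
      rw [show Matrix.single i j (X i j) = X i j • Matrix.single i j (1 : ℝ) by simp, map_smul,
        smul_eq_mul, mul_comm]
    have h2 : φ X = ∑ i, ∑ j, φ (Matrix.single j i 1) * X i j := by
      rw [h1, Finset.sum_comm]
      exact Finset.sum_congr rfl fun i _ => Finset.sum_congr rfl fun j _ => by rw [hX.apply]
    have h3 : φ X = (φ X + φ X) / 2 := by ring
    rw [h3]
    nth_rw 1 [h1]
    rw [h2, ← Finset.sum_add_distrib, Finset.sum_div]
    refine Finset.sum_congr rfl fun i _ => ?_
    rw [← Finset.sum_add_distrib, Finset.sum_div]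
    exact Finset.sum_congr rfl fun j _ => by simp only [Q, Matrix.of_apply]; ring
  have hQ : Q.PosSemidef := by
    refine .of_dotProduct_mulVec_nonneg (Matrix.ext fun i j => ?_) fun u => ?_
    · simp [Q, add_comm]
    · have h1 : 0 ≤ φ (vecMulVec u u) := hgs _ ((hs _).mpr fun w => by
        have := (posSemidef_vecMulVec_self_star u).dotProduct_mulVec_nonneg (M *ᵥ w)
        simpa using this)
      rw [hφ _ (by simp [Matrix.IsSymm, transpose_vecMulVec])] at h1
      refine h1.trans_eq ?_
      simp only [dotProduct, mulVec, Finset.mul_sum, vecMulVec_apply, star_trivial]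
      exact Finset.sum_congr rfl fun i _ => Finset.sum_congr rfl fun j _ => by ring
  obtain ⟨R, hR⟩ := hQ.exists_eq_transpose_mul_self
  refine ⟨R, fun v hv => ?_⟩
  have h1 : l v = g (v, 0) := (hgf ⟨(v, 0), Submodule.subset_span hv, rfl⟩).symm
  have h2 : (R * A v * Rᵀ).trace = (Qᵀ * A v).trace := by
    have hQt : Qᵀ = Q := by simpa using hQ.isHermitian.eq
    rw [Matrix.trace_mul_cycle, ← hR, hQt]
  rw [h1, hgA, h2]
  refine (hφ _ (hA v)).trans ?_
  simp only [Matrix.trace, Matrix.diag, Matrix.mul_apply, Matrix.transpose_apply]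
  exact Finset.sum_comm

open Matrix in
theorem Matrix.posSemidef_fromBlocks_zero_iff {ι κ : Type*} [Fintype ι] [Fintype κ]
    {P : Matrix ι ι ℝ} {Q : Matrix κ κ ℝ} :
    (fromBlocks P 0 0 Q).PosSemidef ↔ P.PosSemidef ∧ Q.PosSemidef := by
  refine ⟨fun h => ⟨?_, ?_⟩, fun ⟨hP, hQ⟩ => ?_⟩
  · exact h.submatrix Sum.inl
  · exact h.submatrix Sum.inr
  · refine .of_dotProduct_mulVec_nonneg (.fromBlocks hP.isHermitian (by simp) hQ.isHermitian)
      fun x => ?_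
    have h1 := hP.dotProduct_mulVec_nonneg (x ∘ Sum.inl)
    have h2 := hQ.dotProduct_mulVec_nonneg (x ∘ Sum.inr)
    rw [fromBlocks_mulVec]
    simpa [dotProduct, Fintype.sum_sum_type] using add_nonneg h1 h2

open Matrix in
/-- An affine function which is nonnegative on a spectrahedron is a sum of squares of linear forms
in the entries of any Gram factorization of the defining pencil. -/
theorem exists_eq_sum_sq_of_nonneg_on_spectrahedron {E ι : Type*} [AddCommGroup E] [Module ℝ E]
    [FiniteDimensional ℝ E] [Fintype ι] (A : Matrix ι ι ℝ) (hA : A.IsSymm)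
    (P : E →ₗ[ℝ] Matrix ι ι ℝ) (hP : ∀ e, (P e).IsSymm) (c : ℝ) (l : E →ₗ[ℝ] ℝ)
    (hne : ∃ e, (A + P e).PosSemidef) (hl : ∀ e, (A + P e).PosSemidef → 0 ≤ c + l e) :
    ∃ R : Matrix (ι ⊕ Unit) (ι ⊕ Unit) ℝ, ∀ (e : E) (W : Matrix (ι ⊕ Unit) (ι ⊕ Unit) ℝ),
      fromBlocks (A + P e) 0 0 1 = Wᵀ * W →
        c + l e = ∑ i, ∑ j, (∑ r, R i r * W j r) * (∑ r, R i r * W j r) := by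
  obtain ⟨e₀, he₀⟩ := hne
  let M : ℝ × E →ₗ[ℝ] Matrix (ι ⊕ Unit) (ι ⊕ Unit) ℝ :=
    { toFun := fun v => fromBlocks (v.1 • A + P v.2) 0 0 (v.1 • 1)
      map_add' := fun v w => by
        rw [fromBlocks_add]
        simp [add_smul, add_add_add_comm]
      map_smul' := fun a v => by
        simp [fromBlocks_smul, mul_smul] }
  have hM : ∀ v, M v = fromBlocks (v.1 • A + P v.2) 0 0 (v.1 • 1) := fun _ => rfl
  let L : ℝ × E →ₗ[ℝ] ℝ := c • LinearMap.fst ℝ ℝ E + l ∘ₗ LinearMap.snd ℝ ℝ E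
  have hL : ∀ v, L v = c * v.1 + l v.2 := fun _ => rfl
  have hpos : ∀ v : ℝ × E, 0 < v.1 → (v.1 • A + P v.2).PosSemidef → 0 ≤ L v := by
    rintro ⟨t, e⟩ ht h
    simp only at ht h
    have h1 := hl (t⁻¹ • e) (by
      have := h.smul (inv_nonneg.mpr ht.le)
      rwa [smul_add, smul_smul, inv_mul_cancel₀ ht.ne', one_smul, ← map_smul] at this)
    have h2 := mul_nonneg ht.le h1
    rw [map_smul, smul_eq_mul, mul_add, mul_inv_cancel_left₀ ht.ne'] at h2
    rw [hL]
    linarith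
  obtain ⟨R, hR⟩ := exists_trace_eq_of_nonneg_of_posSemidef M (fun v => by
      rw [hM]
      exact .fromBlocks (by rw [IsSymm, transpose_add, transpose_smul, hA.eq, (hP _).eq])
        (by simp) (by simp [IsSymm])) L (fun v hv => by
      obtain ⟨h1, h2⟩ := posSemidef_fromBlocks_zero_iff.mp hv
      have ht : 0 ≤ v.1 := by simpa using h2.diag_nonneg (i := ())
      have key : ∀ ε : ℝ, 0 < ε → 0 ≤ L v + ε * L (1, e₀) := fun ε hε => by
        have := hpos (v + ε • (1, e₀)) (by simpa using by positivity) (by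
          have := h1.add (he₀.smul hε.le)
          convert this using 1
          simp [add_smul, add_add_add_comm])
        rwa [map_add, map_smul, smul_eq_mul] at this
      refine le_of_forall_pos_le_add fun δ hδ => ?_
      have hb : 0 < |L (1, e₀)| + 1 := by positivity
      have h3 := key (δ / (|L (1, e₀)| + 1)) (div_pos hδ hb)
      have h4 : δ / (|L (1, e₀)| + 1) * L (1, e₀) ≤ δ := by
        rw [div_mul_eq_mul_div, div_le_iff₀ hb]
        exact mul_le_mul_of_nonneg_left ((le_abs_self _).trans (by linarith)) hδ.le
      linarith)
      {v | v.1 = 1 ∧ (M v).PosSemidef} (fun v hv => hv.2)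
  refine ⟨R, fun e W hW => ?_⟩
  have hMe : M (1, e) = Wᵀ * W := by rw [← hW, hM]; simp
  have h := hR (1, e) ⟨rfl, by
    rw [hMe]
    simpa using posSemidef_conjTranspose_mul_self W⟩
  rw [hL, hMe, ← Matrix.mul_assoc, Matrix.mul_assoc (R * Wᵀ), ← transpose_transpose W,
    ← transpose_mul, transpose_transpose] at h
  simp only [mul_one] at h
  rw [h]
  simp only [Matrix.trace, Matrix.diag_apply, Matrix.mul_apply, Matrix.transpose_apply]

theorem not_spectrahedralShadow_of_translates_not_sos_in_powerSeries
    (n : ℕ) (S : Set (Fin n → ℝ)) (hS : IsSemialgebraic S)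
    (hdense : ∀ f : MvPolynomial (Fin n) ℝ, (∀ ξ ∈ S, MvPolynomial.eval ξ f = 0) → f = 0)
    (L : Submodule ℝ (MvPolynomial (Fin n) ℝ)) (hL : FiniteDimensional ℝ L)
    (h1 : (1 : MvPolynomial (Fin n) ℝ) ∉ L)
    (k : ℕ) (g : Fin k → MvPolynomial (Fin n) ℝ)
    (hgL : ∀ i, g i ∈ L) (hspan : Submodule.span ℝ (Set.range g) = L)
    (hind : LinearIndependent ℝ g)
    (hmain : ∀ η ∈ S, ∃ f ∈ Submodule.span ℝ {(1 : MvPolynomial (Fin n) ℝ)} ⊔ L,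
      (∀ ξ ∈ S, 0 ≤ MvPolynomial.eval ξ f) ∧
      ¬ IsSumSq ((MvPolynomial.aeval
          (fun i => MvPolynomial.X i + MvPolynomial.C (η i)) f :
            MvPolynomial (Fin n) ℝ) : MvPowerSeries (Fin n) ℝ)) :
    ¬ IsSpectrahedralShadow
      (closure (convexHull ℝ ((fun ξ => fun i => MvPolynomial.eval ξ (g i)) '' S))) := by
  rintro ⟨d, m, -, A, B, C, hA, hB, hC, hK⟩
  let φ : (Fin n → ℝ) → Fin k → ℝ := fun ξ i => MvPolynomial.eval ξ (g i)
  let P : (Fin k → ℝ) × (Fin m → ℝ) →ₗ[ℝ] Matrix (Fin d) (Fin d) ℝ :=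
    (Fintype.linearCombination ℝ B).coprod (Fintype.linearCombination ℝ C)
  have hP : ∀ e, A + P e = A + ∑ i, e.1 i • B i + ∑ j, e.2 j • C j := fun e => by
    simp [P, Fintype.linearCombination_apply, add_assoc]
  have hPsymm : ∀ e, (P e).IsSymm := fun e => by
    simp [P, Fintype.linearCombination_apply, Matrix.IsSymm, Matrix.transpose_sum,
      fun i => (hB i).eq, fun j => (hC j).eq]
  have hfac : ∀ ξ, ∃ (η : Fin m → ℝ) (W : Matrix (Fin d ⊕ Unit) (Fin d ⊕ Unit) ℝ), ξ ∈ S →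
      (A + P (φ ξ, η)).PosSemidef ∧ Matrix.fromBlocks (A + P (φ ξ, η)) 0 0 1 = W.transpose * W := by
    intro ξ
    by_cases hξ : ξ ∈ S
    · have hmem : φ ξ ∈ closure (convexHull ℝ (φ '' S)) :=
        subset_closure (subset_convexHull ℝ _ ⟨ξ, hξ, rfl⟩)
      rw [hK] at hmem
      obtain ⟨η, hη⟩ := hmem
      have hpsd : (A + P (φ ξ, η)).PosSemidef := by rw [hP]; exact hη
      obtain ⟨W, hW⟩ := (Matrix.posSemidef_fromBlocks_zero_iff (κ := Unit) (Q := 1).mpr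
        ⟨hpsd, .one⟩).exists_eq_transpose_mul_self
      exact ⟨η, W, fun _ => ⟨hpsd, hW⟩⟩
    · exact ⟨0, 0, fun h => absurd h hξ⟩
  choose η W hW using hfac
  obtain ⟨s, hs, Ψ, hΨC, hΨ⟩ := exists_formal_section_of_zariski_dense
    (τ := (Fin d ⊕ Unit) × (Fin d ⊕ Unit)) hdense (fun ξ p => W ξ p.1 p.2)
  obtain ⟨f, hf, hfS, hfnot⟩ := hmain s hs
  rw [← hspan] at hf
  obtain ⟨_, hc, _, ha, rfl⟩ := Submodule.mem_sup.mp hf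
  obtain ⟨c, rfl⟩ := Submodule.mem_span_singleton.mp hc
  obtain ⟨a, rfl⟩ := (Submodule.mem_span_range_iff_exists_fun ℝ).mp ha
  set f := c • (1 : MvPolynomial (Fin n) ℝ) + ∑ i, a i • g i with hfdef
  let l : (Fin k → ℝ) →ₗ[ℝ] ℝ := Fintype.linearCombination ℝ a
  have hf_eval : ∀ ξ, MvPolynomial.eval ξ f = c + l (φ ξ) := fun ξ => by
    simp [hfdef, l, φ, Fintype.linearCombination_apply, MvPolynomial.smul_eval, mul_comm]
  have hK_nonneg : closure (convexHull ℝ (φ '' S)) ⊆ {x | 0 ≤ c + l x} := by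
    refine closure_minimal (convexHull_min ?_ ?_) ?_
    · rintro _ ⟨ξ, hξ, rfl⟩
      exact (hfS ξ hξ).trans_eq (hf_eval ξ)
    · have : {x | 0 ≤ c + l x} = {x | -c ≤ l x} := by ext x; simp [neg_le_iff_add_nonneg']
      rw [this]
      exact convex_halfSpace_ge l.isLinear _
    · exact isClosed_le continuous_const (continuous_const.add l.continuous_of_finiteDimensional)
  obtain ⟨R, hR⟩ := exists_eq_sum_sq_of_nonneg_on_spectrahedron A hA P hPsymm c
    (l ∘ₗ LinearMap.fst ℝ _ _) ⟨_, (hW s hs).1⟩ (fun e he => by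
      have hmem : e.1 ∈ closure (convexHull ℝ (φ '' S)) := by
        rw [hK]
        exact ⟨e.2, by rwa [← hP]⟩
      exact hK_nonneg hmem)
  let q : Fin d ⊕ Unit → Fin d ⊕ Unit →
      MvPolynomial ((Fin d ⊕ Unit) × (Fin d ⊕ Unit)) (MvPolynomial (Fin n) ℝ) :=
    fun i j => ∑ r, MvPolynomial.C (MvPolynomial.C (R i r)) * MvPolynomial.X (j, r)
  have h0 := hΨ (MvPolynomial.C f - ∑ i, ∑ j, q i j * q i j) (fun ξ hξ => by
    have h := hR _ _ (hW ξ hξ).2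
    rw [LinearMap.comp_apply, LinearMap.fst_apply, ← hf_eval] at h
    simp [q, MvPolynomial.eval₂_sum, h])
  refine hfnot ?_
  rw [← hΨC, show Ψ (MvPolynomial.C f) = ∑ i, ∑ j, Ψ (q i j) * Ψ (q i j) by
    rw [map_sub, sub_eq_zero] at h0
    simp [h0]]
  exact IsSumSq.sum fun i _ => IsSumSq.sum fun j _ => .mul_self _
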